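/- Let G = (V, E, w) be a weighted graph with |V| = n, let V₁, …, V_k be a partition of V with map π, let E₀ be the set of edges of E with endpoints in two different parts, G₀ = (V, E₀, w), E₁ = E − E₀, and G₁ = (V, E₁, w). Let 0 < ε < 1/2 and c ≥ 3, and let G̃₀ be a pullback under π of a (1+ε)-spectral approximation of the contraction of G₀ under π. Assume (1) each induced subgraph (V_i, edges of E₁ inside V_i) is connected, (2) every edge in E₁ has weight at least c²·n³, and (3) every edge in E₀ has weight 1. Then G̃₀ + G₁ is an α-spectral approximation of G for α = (1+ε)(1+1/c)². -/

import Mathlib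

/-- The Laplacian quadratic form of a weighted graph given by a symmetric
weight function.  The double sum counts every unordered edge twice, whence the
factor `1/2`. -/
noncomputable def lapQ {m : ℕ} (w : Fin m → Fin m → ℝ) (x : Fin m → ℝ) : ℝ :=
  (1 / 2) * ∑ u, ∑ v, w u v * (x u - x v) ^ 2

/-- The contraction of a weighted graph (given by a symmetric weight function
`w` on `Fin n`) under the map `π` of a partition: the weight of the edge
`(i,j)`, `i ≠ j`, is the total weight of the edges of `w` joining the parts
`π⁻¹(i)` and `π⁻¹(j)`; self-loops are discarded.  (Each unordered edge `{u,v}`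
with `π u = i ≠ j = π v` is counted exactly once by the ordered double sum.) -/
noncomputable def contractW {n k : ℕ} (π : Fin n → Fin k)
    (w : Fin n → Fin n → ℝ) : Fin k → Fin k → ℝ :=
  fun i j => if i = j then 0
    else ∑ u, ∑ v, if π u = i ∧ π v = j then w u v else 0

/-- `wt` (a symmetric weight function on `Fin n`) is a pullback under `π` of
the weighted graph `z` on `Fin k`: all its edges join distinct parts, its
contraction under `π` is `z`, and for every edge `(i,j)` of `z` there is
exactly one edge of `wt` joining the parts `π⁻¹(i)` and `π⁻¹(j)`. -/
def IsPullback {n k : ℕ} (π : Fin n → Fin k) (wt : Fin n → Fin n → ℝ)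
    (z : Fin k → Fin k → ℝ) : Prop :=
  (∀ u v, π u = π v → wt u v = 0) ∧
  contractW π wt = z ∧
  (∀ i j, z i j ≠ 0 →
    ∃! e : Fin n × Fin n, π e.1 = i ∧ π e.2 = j ∧ wt e.1 e.2 ≠ 0)

theorem pb_contract_sum {n k : ℕ} (π : Fin n → Fin k) (w : Fin n → Fin n → ℝ)
    (h : ∀ u v, π u = π v → w u v = 0) (f : Fin k → Fin k → ℝ) :
    ∑ i, ∑ j, contractW π w i j * f i j = ∑ u, ∑ v, w u v * f (π u) (π v) := by
  have h1 : ∀ i j, contractW π w i j * f i j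
      = ∑ u, ∑ v, if π u = i ∧ π v = j then w u v * f (π u) (π v) else 0 := by
    intro i j
    unfold contractW
    split_ifs with hij
    · subst hij
      rw [zero_mul]
      symm
      refine Finset.sum_eq_zero fun u _ => Finset.sum_eq_zero fun v _ => ?_
      split_ifs with hh
      · rw [h u v (hh.1.trans hh.2.symm), zero_mul]
      · rfl
    · rw [Finset.sum_mul]
      refine Finset.sum_congr rfl fun u _ => ?_
      rw [Finset.sum_mul]
      refine Finset.sum_congr rfl fun v _ => ?_
      split_ifs with hh
      · rw [hh.1, hh.2]
      · simp
  simp_rw [h1]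
  have h2 : ∀ i, ∑ j, ∑ u, ∑ v, (if π u = i ∧ π v = j then w u v * f (π u) (π v) else 0)
      = ∑ u, ∑ v, if π u = i then w u v * f (π u) (π v) else 0 := by
    intro i
    rw [Finset.sum_comm]
    refine Finset.sum_congr rfl fun u _ => ?_
    rw [Finset.sum_comm]
    refine Finset.sum_congr rfl fun v _ => ?_
    by_cases hu : π u = i <;> simp [hu]
  simp_rw [h2]
  rw [Finset.sum_comm]
  refine Finset.sum_congr rfl fun u _ => ?_
  rw [Finset.sum_comm]
  refine Finset.sum_congr rfl fun v _ => ?_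
  simp

theorem pb_lapQ_contract {n k : ℕ} (π : Fin n → Fin k) (w : Fin n → Fin n → ℝ)
    (h : ∀ u v, π u = π v → w u v = 0) (y : Fin k → ℝ) :
    lapQ (contractW π w) y = lapQ w (fun u => y (π u)) := by
  unfold lapQ
  rw [pb_contract_sum π w h (fun i j => (y i - y j) ^ 2)]

theorem pb_sum_single {k : ℕ} (z : Fin k → Fin k → ℝ) (hz : ∀ i, z i i = 0) :
    ∑ i, lapQ z (Pi.single i 1) = ∑ u, ∑ v, z u v := by
  unfold lapQ
  rw [← Finset.mul_sum, Finset.sum_comm]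
  rw [Finset.mul_sum]
  refine Finset.sum_congr rfl fun u _ => ?_
  rw [Finset.sum_comm, Finset.mul_sum]
  refine Finset.sum_congr rfl fun v _ => ?_
  by_cases huv : u = v
  · subst huv; simp [hz]
  · have : ∀ i : Fin k, z u v * ((Pi.single i (1:ℝ) : Fin k → ℝ) u - (Pi.single i (1:ℝ) : Fin k → ℝ) v) ^ 2
        = (if u = i then z u v else 0) + (if v = i then z u v else 0) := by
      intro i
      by_cases h1 : u = i
      · have h2 : v ≠ i := fun h => huv (h1.trans h.symm)
        simp [h1, h2]
      · by_cases h2 : v = i <;> simp [h1, h2]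
    simp_rw [this, Finset.sum_add_distrib]
    simp
    ring

theorem pb_lapQ_mono {n : ℕ} (w : Fin n → Fin n → ℝ) (hw : ∀ u v, 0 ≤ w u v) (c : ℝ) (hc : 0 < c)
    (d : ℝ) (x y : Fin n → ℝ)
    (hd : ∀ u v, ((x u - y u) - (x v - y v)) ^ 2 ≤ d) :
    lapQ w x ≤ (1 + 1 / c) * lapQ w y + (1 + c) * ((1 / 2) * (∑ u, ∑ v, w u v) * d) := by
  have key : ∑ u, ∑ v, w u v * (x u - x v) ^ 2 ≤
      ∑ u, ∑ v, ((1 + 1 / c) * (w u v * (y u - y v) ^ 2) + (1 + c) * d * w u v) := by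
    refine Finset.sum_le_sum fun u _ => Finset.sum_le_sum fun v _ => ?_
    have h1 : (x u - x v) ^ 2 ≤ (1 + 1 / c) * (y u - y v) ^ 2 + (1 + c) * d := by
      have := hd u v
      set A := y u - y v with hA
      set B := (x u - y u) - (x v - y v) with hB
      have hx : x u - x v = A + B := by rw [hA, hB]; ring
      rw [hx]
      have h2 : (1 + 1 / c) * A ^ 2 + (1 + c) * B ^ 2 - (A + B) ^ 2 = (A - c * B) ^ 2 / c := by
        field_simp; ring
      have h3 : 0 ≤ (A - c * B) ^ 2 / c := by positivity
      have h4 : (1 + c) * B ^ 2 ≤ (1 + c) * d := by gcongr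
      linarith
    calc w u v * (x u - x v) ^ 2 ≤ w u v * ((1 + 1 / c) * (y u - y v) ^ 2 + (1 + c) * d) :=
          mul_le_mul_of_nonneg_left h1 (hw u v)
      _ = _ := by ring
  simp_rw [Finset.sum_add_distrib, ← Finset.mul_sum] at key
  unfold lapQ
  linarith

theorem pb_arith1 (ε r : ℝ) (hε0 : 0 < ε) (hε : ε < 1 / 2) (hr0 : 0 < r) (hr3 : r ≤ 1 / 3) :
    (1 + ε) * ((1 + r) ^ 2 * r / 2 + (1 + r) * r / 2) + 1 ≤ (1 + ε) * (1 + r) ^ 2 := by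
  have : 0 ≤ 2 * r + r ^ 2 - ((1 + r) ^ 2 * r / 2 + (1 + r) * r / 2) := by
    nlinarith [sq_nonneg r, mul_pos hr0 hr0, mul_nonneg hr0.le (sub_nonneg.2 hr3), mul_nonneg (mul_nonneg hr0.le hr0.le) (sub_nonneg.2 hr3)]
  nlinarith

theorem pb_arith2 (ε r : ℝ) (hε0 : 0 < ε) (hε : ε < 1 / 2) (hr0 : 0 < r) (hr3 : r ≤ 1 / 3) :
    (1 + ε) ^ 2 * ((1 + r) ^ 2 * r / 2) + (1 + r) * r / 2 + 1
        ≤ (1 + ε) * (1 + r) ^ 2 := by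
  have t1 : (1 + ε) * r / 2 ≤ r * (3 / 4) := by nlinarith
  have t2 : (1 + ε) ^ 2 * ((1 + r) ^ 2 * r / 2) ≤ (1 + ε) * (1 + r) ^ 2 * (r * (3 / 4)) := by
    have := mul_le_mul_of_nonneg_left t1 (show 0 ≤ (1 + ε) * (1 + r) ^ 2 by positivity)
    linarith
  have t3 : (1 + r) * r / 2 + 1 ≤ (1 + r) ^ 2 * (1 - r * (3 / 4)) := by
    nlinarith [mul_nonneg hr0.le (sub_nonneg.2 hr3), mul_nonneg (mul_nonneg hr0.le hr0.le) (sub_nonneg.2 hr3)]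
  have t4 : 0 ≤ ε * ((1 + r) ^ 2 * (1 - r * (3 / 4))) := by
    have : 0 ≤ 1 - r * (3 / 4) := by linarith
    positivity
  linarith

theorem pb_path {n : ℕ} (H : SimpleGraph (Fin n)) (x : Fin n → ℝ) (B : ℝ)
    (hB : 0 ≤ B)
    (F : Fin n → Fin n → ℝ) (hF : ∀ a b, 0 ≤ F a b) (hs : ∀ a b, F a b = F b a)
    (hH : ∀ a b, H.Adj a b → B * (x a - x b) ^ 2 ≤ F a b) {u v : Fin n} (p : H.Walk u v)
    (hp : p.IsPath) :
    B * (x u - x v) ^ 2 ≤ p.length *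
      ((1 / 2) * ∑ a ∈ p.support.toFinset, ∑ b ∈ p.support.toFinset, F a b) := by
  induction p with
  | nil => simp
  | @cons u u' v h p ih =>
    rw [SimpleGraph.Walk.cons_isPath_iff] at hp
    have ih := ih hp.1
    have hu' : u' ∈ p.support.toFinset := by simp
    have hu : u ∉ p.support.toFinset := by simpa using hp.2
    rw [SimpleGraph.Walk.support_cons, List.toFinset_cons, SimpleGraph.Walk.length_cons]
    set S := p.support.toFinset with hS
    rw [Finset.sum_insert hu, Finset.sum_insert hu]
    simp_rw [Finset.sum_insert hu]
    rw [Finset.sum_add_distrib]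
    have e1 : F u u' ≤ ∑ b ∈ S, F u b :=
      Finset.single_le_sum (f := fun b => F u b) (fun b _ => hF u b) hu'
    have e2 : ∑ a ∈ S, F a u = ∑ b ∈ S, F u b := Finset.sum_congr rfl fun a _ => hs a u
    rw [e2]
    have e3 := hH u u' h
    have e4 := hF u u
    set T := (1 / 2) * ∑ a ∈ S, ∑ b ∈ S, F a b with hT
    set l : ℝ := (p.length : ℝ) with hl
    have hl0 : 0 ≤ l := by positivity
    push_cast
    have hT0 : 0 ≤ T := by
      rw [hT]
      have := Finset.sum_nonneg fun a (_ : a ∈ S) => Finset.sum_nonneg fun b (_ : b ∈ S) => hF a b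
      positivity
    have e5 : (l + 1) * (B * (x u - x u') ^ 2 + T) ≤ (l + 1) * ((1 / 2) * (F u u + ∑ b ∈ S, F u b + (∑ b ∈ S, F u b + ∑ a ∈ S, ∑ b ∈ S, F a b))) := by
      apply mul_le_mul_of_nonneg_left _ (by positivity)
      linarith
    refine le_trans ?_ e5
    rcases Nat.eq_zero_or_pos p.length with h0 | h0
    · have : l = 0 := by rw [hl, h0]; simp
      have hv : u' = v := SimpleGraph.Walk.eq_of_length_eq_zero h0
      subst hv
      rw [this]
      linarith
    · have hlp : 0 < l := by rw [hl]; exact_mod_cast h0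
      have e6 : (x u - x v) ^ 2 ≤ (l + 1) * (x u - x u') ^ 2 + (1 + 1 / l) * (x u' - x v) ^ 2 := by
        have : (l + 1) * (x u - x u') ^ 2 + (1 + 1 / l) * (x u' - x v) ^ 2 - (x u - x v) ^ 2
          = (l * (x u - x u') - (x u' - x v)) ^ 2 / l := by field_simp; ring
        have h3 : 0 ≤ (l * (x u - x u') - (x u' - x v)) ^ 2 / l := by positivity
        linarith
      have e7 := mul_le_mul_of_nonneg_left e6 hB
      have e8 : (1 + 1 / l) * (B * (x u' - x v) ^ 2) ≤ (1 + 1 / l) * (l * T) :=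
        mul_le_mul_of_nonneg_left ih (by positivity)
      have e9 : (1 + 1 / l) * (l * T) = (l + 1) * T := by field_simp
      linarith

/--
**Pullback Lemma.**
Let `G = (V,E,w)` be a weighted graph on `n` vertices, `π` the map of a
partition `V₁,…,V_k` of `V`, `E₀` the crossing edges, `E₁ = E − E₀` the
internal edges, `G₀ = (V,E₀,w)` and `G₁ = (V,E₁,w)`.  Let `0 < ε < 1/2` and
`c ≥ 3`, and let `G̃₀` (weight `wt₀`) be a pullback under `π` of a
`(1+ε)`-spectral approximation `z̃` of the contraction of `G₀` under `π`.
Assume (1) every part is connected by edges of `E₁`, (2) every edge of `E₁`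
has weight at least `c²n³`, and (3) every edge of `E₀` has weight `1`.  Then
`G̃₀ + G₁` is an `α`-spectral approximation of `G` for
`α = (1+ε)(1+1/c)²`.
-/
theorem stmt10 {n k : ℕ} (w : Fin n → Fin n → ℝ)
    (hsymm : ∀ u v, w u v = w v u) (hnonneg : ∀ u v, 0 ≤ w u v)
    (hloop : ∀ v, w v v = 0)
    (π : Fin n → Fin k) (ε c : ℝ) (hε0 : 0 < ε) (hε : ε < 1 / 2) (hc : 3 ≤ c)
    (w₀ w₁ : Fin n → Fin n → ℝ)
    (hw₀ : ∀ u v, w₀ u v = if π u ≠ π v then w u v else 0)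
    (hw₁ : ∀ u v, w₁ u v = if π u = π v then w u v else 0)
    (wt₀ : Fin n → Fin n → ℝ)
    (hwtsymm : ∀ u v, wt₀ u v = wt₀ v u) (hwtnonneg : ∀ u v, 0 ≤ wt₀ u v)
    (z : Fin k → Fin k → ℝ)
    -- `z` is a `(1+ε)`-spectral approximation of the contraction of `G₀`
    (happrox : ∀ y : Fin k → ℝ,
      (1 / (1 + ε)) * lapQ z y ≤ lapQ (contractW π w₀) y ∧
        lapQ (contractW π w₀) y ≤ (1 + ε) * lapQ z y)
    -- `G̃₀` is a pullback of `z` under `π`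
    (hpull : IsPullback π wt₀ z)
    -- (1): each part `V_i` is connected by the edges of `E₁`
    (hconn : ∀ u v : Fin n, π u = π v →
      (SimpleGraph.fromRel fun a b => w a b ≠ 0 ∧ π a = π b).Reachable u v)
    -- (2): every edge of `E₁` has weight at least `c² n³`
    (hbig : ∀ u v, π u = π v → w u v ≠ 0 → c ^ 2 * (n : ℝ) ^ 3 ≤ w u v)
    -- (3): every edge of `E₀` has weight `1`
    (hone : ∀ u v, π u ≠ π v → w u v ≠ 0 → w u v = 1) :
    ∀ x : Fin n → ℝ,
      (1 / ((1 + ε) * (1 + 1 / c) ^ 2)) * lapQ (fun u v => wt₀ u v + w₁ u v) x ≤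
          lapQ w x ∧
        lapQ w x ≤ (1 + ε) * (1 + 1 / c) ^ 2 * lapQ (fun u v => wt₀ u v + w₁ u v) x := by
  intro x
  have hc0 : 0 < c := by linarith
  obtain ⟨hp1, hp2, -⟩ := hpull
  have hw00 : ∀ u v, π u = π v → w₀ u v = 0 := fun u v h => by rw [hw₀]; simp [h]
  have hw0n : ∀ u v, 0 ≤ w₀ u v := fun u v => by
    rw [hw₀]; split_ifs; exacts [hnonneg u v, le_rfl]
  have hw0le : ∀ u v, w₀ u v ≤ 1 := fun u v => by
    rw [hw₀]
    split_ifs with h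
    · by_cases h' : w u v = 0
      · rw [h']; norm_num
      · exact (hone u v h h').le
    · norm_num
  have hw1n : ∀ u v, 0 ≤ w₁ u v := fun u v => by
    rw [hw₁]; split_ifs; exacts [hnonneg u v, le_rfl]
  have hsum0 : ∑ u, ∑ v, w₀ u v ≤ (n : ℝ) ^ 2 := by
    calc ∑ u, ∑ v, w₀ u v ≤ ∑ u : Fin n, ∑ v : Fin n, (1 : ℝ) :=
          Finset.sum_le_sum fun u _ => Finset.sum_le_sum fun v _ => hw0le u v
      _ = (n : ℝ) ^ 2 := by simp [sq]
  have htot : ∀ w' : Fin n → Fin n → ℝ, (∀ u v, π u = π v → w' u v = 0) →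
      ∑ i, lapQ (contractW π w') (Pi.single i 1) = ∑ u, ∑ v, w' u v := by
    intro w' h
    rw [pb_sum_single _ (fun i => by simp [contractW])]
    simpa using pb_contract_sum π w' h (fun _ _ => 1)
  have hzle : ∀ y, lapQ z y ≤ (1 + ε) * lapQ (contractW π w₀) y := fun y => by
    have := (happrox y).1
    rw [one_div, inv_mul_le_iff₀ (by linarith)] at this
    exact this
  have hsumt : ∑ u, ∑ v, wt₀ u v ≤ (1 + ε) * (n : ℝ) ^ 2 := by
    rw [← htot wt₀ hp1, hp2]
    calc ∑ i, lapQ z (Pi.single i 1)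
        ≤ ∑ i, (1 + ε) * lapQ (contractW π w₀) (Pi.single i 1) :=
          Finset.sum_le_sum fun i _ => hzle _
      _ = (1 + ε) * ∑ u, ∑ v, w₀ u v := by rw [← Finset.mul_sum, htot w₀ hw00]
      _ ≤ _ := by gcongr
  -- decomposition
  have hQw : lapQ w x = lapQ w₀ x + lapQ w₁ x := by
    unfold lapQ
    rw [← mul_add, ← Finset.sum_add_distrib]
    congr 1
    refine Finset.sum_congr rfl fun u _ => ?_
    rw [← Finset.sum_add_distrib]
    refine Finset.sum_congr rfl fun v _ => ?_
    rw [hw₀, hw₁]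
    by_cases h : π u = π v <;> simp [h]
  have hQt : lapQ (fun u v => wt₀ u v + w₁ u v) x = lapQ wt₀ x + lapQ w₁ x := by
    unfold lapQ
    rw [← mul_add, ← Finset.sum_add_distrib]
    congr 1
    refine Finset.sum_congr rfl fun u _ => ?_
    rw [← Finset.sum_add_distrib]
    refine Finset.sum_congr rfl fun v _ => ?_
    ring
  have hQnn : ∀ w' : Fin n → Fin n → ℝ, (∀ u v, 0 ≤ w' u v) → ∀ x, 0 ≤ lapQ w' x := by
    intro w' h x
    unfold lapQ
    have := Finset.sum_nonneg fun a (_ : a ∈ (Finset.univ : Finset (Fin n))) =>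
      Finset.sum_nonneg fun b (_ : b ∈ (Finset.univ : Finset (Fin n))) =>
        mul_nonneg (h a b) (sq_nonneg (x a - x b))
    positivity
  have hq := hQnn w₁ hw1n x
  have hA := hQnn w₀ hw0n x
  have hT := hQnn wt₀ hwtnonneg x
  rw [hQw, hQt]
  set q := lapQ w₁ x with hqdef
  set d := q / (c ^ 2 * (n : ℝ) ^ 2) with hd
  have hd0 : 0 ≤ d := by positivity
  have hin : ∀ u v, π u = π v → (x u - x v) ^ 2 ≤ d := by
    intro u v huv
    have hn : (0 : ℝ) < n := by exact_mod_cast u.pos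
    obtain ⟨p, hp⟩ := (hconn u v huv).exists_isPath
    have h1 := pb_path _ x (c ^ 2 * (n : ℝ) ^ 3) (by positivity)
      (fun a b => w₁ a b * (x a - x b) ^ 2) (fun a b => mul_nonneg (hw1n a b) (sq_nonneg _))
      (fun a b => by
        have : w₁ a b = w₁ b a := by rw [hw₁, hw₁, hsymm a b]; simp [eq_comm]
        rw [this]; ring)
      (fun a b hab => by
        rw [SimpleGraph.fromRel_adj] at hab
        have hab' : w a b ≠ 0 ∧ π a = π b := by
          rcases hab.2 with h | h
          · exact h
          · exact ⟨by rw [hsymm]; exact h.1, h.2.symm⟩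
        have : c ^ 2 * (n : ℝ) ^ 3 ≤ w₁ a b := by
          rw [hw₁, if_pos hab'.2]; exact hbig a b hab'.2 hab'.1
        exact mul_le_mul_of_nonneg_right this (sq_nonneg _)) p hp
    have h2 : (1 / 2) * ∑ a ∈ p.support.toFinset, ∑ b ∈ p.support.toFinset,
        w₁ a b * (x a - x b) ^ 2 ≤ q := by
      rw [hqdef]
      unfold lapQ
      have hnn : ∀ a b, 0 ≤ w₁ a b * (x a - x b) ^ 2 :=
        fun a b => mul_nonneg (hw1n a b) (sq_nonneg _)
      apply mul_le_mul_of_nonneg_left _ (by norm_num)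
      refine (Finset.sum_le_sum fun a _ => Finset.sum_le_sum_of_subset_of_nonneg
        (Finset.subset_univ _) fun b _ _ => hnn a b).trans ?_
      exact Finset.sum_le_sum_of_subset_of_nonneg
        (Finset.subset_univ _) fun a _ _ => Finset.sum_nonneg fun b _ => hnn a b
    have h3 : (p.length : ℝ) ≤ n := by
      have := hp.length_lt
      rw [Fintype.card_fin] at this
      exact_mod_cast this.le
    have h4 : c ^ 2 * (n : ℝ) ^ 3 * (x u - x v) ^ 2 ≤ n * q :=
      h1.trans ((mul_le_mul_of_nonneg_left h2 (by positivity)).trans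
        (mul_le_mul_of_nonneg_right h3 hq))
    rw [hd, le_div_iff₀ (by positivity)]
    refine le_of_mul_le_mul_left ?_ hn
    linarith
  -- representatives
  have hrep : ∀ i : Fin k, ∃ t : ℝ, ∀ u, π u = i → |x u - t| ≤ √d / 2 := by
    intro i
    by_cases hne : (Finset.univ.filter fun u => π u = i).Nonempty
    · obtain ⟨m, hm, hmax⟩ := Finset.exists_max_image _ x hne
      refine ⟨x m - √d / 2, fun u hu => ?_⟩
      have h1 := hmax u (by simp [hu])
      have h2 := Real.abs_le_sqrt (hin m u ((Finset.mem_filter.1 hm).2.trans hu.symm))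
      rw [abs_le] at h2 ⊢
      constructor <;> linarith [h2.1, h2.2]
    · refine ⟨0, fun u hu => absurd ⟨u, by simp [hu]⟩ hne⟩
  choose y hy using hrep
  have hdiff : ∀ u v, ((x u - y (π u)) - (x v - y (π v))) ^ 2 ≤ d := by
    intro u v
    have h1 := abs_le.1 (hy (π u) u rfl)
    have h2 := abs_le.1 (hy (π v) v rfl)
    rw [← Real.sq_sqrt hd0]
    apply sq_le_sq'
    · linarith [h1.1, h2.2]
    · linarith [h1.2, h2.1]
  have hdiff' : ∀ u v, ((y (π u) - x u) - (y (π v) - x v)) ^ 2 ≤ d := by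
    intro u v
    have := hdiff u v
    linarith
  have hnd : (n : ℝ) ^ 2 * d ≤ q / c ^ 2 := by
    rcases eq_or_ne (n : ℝ) 0 with h | h
    · rw [h]; simp; positivity
    · rw [hd]; apply le_of_eq; field_simp
  have hd1 : (∑ u, ∑ v, w₀ u v) * d ≤ q / c ^ 2 :=
    (mul_le_mul_of_nonneg_right hsum0 hd0).trans hnd
  have hd2 : (∑ u, ∑ v, wt₀ u v) * d ≤ (1 + ε) * (q / c ^ 2) := by
    refine (mul_le_mul_of_nonneg_right hsumt hd0).trans ?_
    rw [mul_assoc]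
    exact mul_le_mul_of_nonneg_left hnd (by linarith)
  have a1 := pb_lapQ_mono w₀ hw0n c hc0 d x (fun u => y (π u)) hdiff
  have a2 := pb_lapQ_mono w₀ hw0n c hc0 d (fun u => y (π u)) x hdiff'
  have b1 := pb_lapQ_mono wt₀ hwtnonneg c hc0 d x (fun u => y (π u)) hdiff
  have b2 := pb_lapQ_mono wt₀ hwtnonneg c hc0 d (fun u => y (π u)) x hdiff'
  have z1 := (happrox y).2
  have z2 := hzle y
  rw [← hp2, pb_lapQ_contract π w₀ hw00, pb_lapQ_contract π wt₀ hp1] at z1 z2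
  set A := lapQ w₀ x
  set T := lapQ wt₀ x
  set A' := lapQ w₀ (fun u => y (π u))
  set T' := lapQ wt₀ (fun u => y (π u))
  obtain ⟨r, hr⟩ : ∃ r, r = 1 / c := ⟨_, rfl⟩
  have hr0 : 0 < r := by rw [hr]; positivity
  have hr3 : r ≤ 1 / 3 := by rw [hr]; exact one_div_le_one_div_of_le (by norm_num) hc
  have hcr : ∀ D e : ℝ, D ≤ e * (q / c ^ 2) →
      (1 + c) * ((1 / 2) * D) ≤ e * ((1 + r) * r / 2 * q) := by
    intro D e h
    have : (1 + c) * ((1 / 2) * D) ≤ (1 + c) * ((1 / 2) * (e * (q / c ^ 2))) := by gcongr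
    refine this.trans (le_of_eq ?_)
    rw [hr]; field_simp; ring
  have k1 := hcr ((∑ u, ∑ v, w₀ u v) * d) 1 (by rw [one_mul]; exact hd1)
  have k2 := hcr _ (1 + ε) hd2
  simp only [mul_assoc] at a1 a2 b1 b2 k1 k2
  rw [← hr] at a1 a2 b1 b2 ⊢
  constructor
  · rw [one_div, inv_mul_le_iff₀ (by positivity)]
    have s1 : A' ≤ (1 + r) * A + (1 + r) * r / 2 * q := by linarith
    have s2 : T' ≤ (1 + ε) * ((1 + r) * A + (1 + r) * r / 2 * q) :=
      z2.trans (mul_le_mul_of_nonneg_left s1 (by linarith))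
    have s3 : (1 + r) * T' ≤ (1 + r) * ((1 + ε) * ((1 + r) * A + (1 + r) * r / 2 * q)) :=
      mul_le_mul_of_nonneg_left s2 (by linarith)
    have s4 : (1 + ε) * ((1 + r) ^ 2 * r / 2 + (1 + r) * r / 2) + 1 ≤ (1 + ε) * (1 + r) ^ 2 :=
      pb_arith1 ε r hε0 hε hr0 hr3
    have s5 := mul_le_mul_of_nonneg_right s4 hq
    linarith
  · have s1 : T' ≤ (1 + r) * T + (1 + ε) * ((1 + r) * r / 2 * q) := by linarith
    have s2 : A' ≤ (1 + ε) * ((1 + r) * T + (1 + ε) * ((1 + r) * r / 2 * q)) :=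
      z1.trans (mul_le_mul_of_nonneg_left s1 (by linarith))
    have s3 : (1 + r) * A' ≤
        (1 + r) * ((1 + ε) * ((1 + r) * T + (1 + ε) * ((1 + r) * r / 2 * q))) :=
      mul_le_mul_of_nonneg_left s2 (by linarith)
    have s4 : (1 + ε) ^ 2 * ((1 + r) ^ 2 * r / 2) + (1 + r) * r / 2 + 1
        ≤ (1 + ε) * (1 + r) ^ 2 :=
      pb_arith2 ε r hε0 hε hr0 hr3
    have s5 := mul_le_mul_of_nonneg_right s4 hq
    linarith
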